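/- Let Ω ⊆ ℝ^{m+1} (m ≥ 1) be a domain and let e₁,...,e_{m+1} be linearly independent C^∞ vector fields on Ω. Consider the operator Q′φ = a^{ij}(x, e₁φ,...,e_{m+1}φ) e_i e_j φ + b(x, φ, e₁φ,...,e_{m+1}φ), with a^{ij} and b C^∞ in all their arguments. Let φ, ψ ∈ C^∞(Ω) satisfy Q′φ ≥ Q′ψ in Ω. Assume: (1) the matrix (a^{ij}) is symmetric and nonnegative definite; (2) ∂b/∂z ≤ 0 (z the argument in which φ appears); (3) there exist C^∞ vector fields X₁,...,X_r and Y on Ω such that, as second-order differential operators, a^{ij}(x, e₁φ(x),...,e_{m+1}φ(x)) e_i e_j = Σ_{k=1}^r X_k² + Y. Let Γ be an integral curve of a vector field Z ∈ £(X₁,...,X_r). If φ − ψ attains a nonnegative maximum over Ω at a point of Γ, then φ − ψ equals that maximum at every point of Γ. -/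

import Mathlib

open Set Finset

noncomputable section

/-- Derivative of `f` along the vector field `X`. -/
def vApp {N : ℕ} (X : (Fin N → ℝ) → (Fin N → ℝ)) (f : (Fin N → ℝ) → ℝ) (x : Fin N → ℝ) : ℝ :=
  fderiv ℝ f x (X x)

/-- Lie bracket of vector fields. -/
def lieBr {N : ℕ} (X Y : (Fin N → ℝ) → (Fin N → ℝ)) : (Fin N → ℝ) → (Fin N → ℝ) :=
  fun x => fderiv ℝ Y x (X x) - fderiv ℝ X x (Y x)

/-- `£(S)`: the smallest `C^∞`-module of vector fields containing `S`
and closed under Lie bracket. -/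
inductive LieSpan {N : ℕ} (Ω : Set (Fin N → ℝ)) (S : Set ((Fin N → ℝ) → (Fin N → ℝ))) :
    ((Fin N → ℝ) → (Fin N → ℝ)) → Prop
  | base : ∀ X ∈ S, LieSpan Ω S X
  | smul : ∀ (f : (Fin N → ℝ) → ℝ) (X : (Fin N → ℝ) → (Fin N → ℝ)),
      ContDiffOn ℝ (⊤ : ℕ∞) f Ω → LieSpan Ω S X → LieSpan Ω S (fun x => f x • X x)
  | add : ∀ X Y, LieSpan Ω S X → LieSpan Ω S Y → LieSpan Ω S (fun x => X x + Y x)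
  | bracket : ∀ X Y, LieSpan Ω S X → LieSpan Ω S Y → LieSpan Ω S (lieBr X Y)

/-- The moving-frame quasilinear operator
`Q′φ = a^{ij}(x, e₁φ,...,e_{m+1}φ) e_i e_j φ + b(x, φ, e₁φ,...,e_{m+1}φ)`. -/
def Qop' (N : ℕ) (e : Fin N → ((Fin N → ℝ) → (Fin N → ℝ)))
    (a : (Fin N → ℝ) → (Fin N → ℝ) → Matrix (Fin N) (Fin N) ℝ)
    (b : (Fin N → ℝ) → ℝ → (Fin N → ℝ) → ℝ)
    (f : (Fin N → ℝ) → ℝ) (x : Fin N → ℝ) : ℝ :=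
  (∑ i, ∑ j, a x (fun k => vApp (e k) f x) i j * vApp (e i) (vApp (e j) f) x)
    + b x (f x) (fun k => vApp (e k) f x)

open Filter Topology Matrix

/-- `ν` is, up to scaling, a proximal (Bony) normal to `F` at `x`: near `x`, the open Euclidean ball
centred at `x + ν` with `x` on its boundary does not meet `F`. -/
def NormalAt {N : ℕ} (F : Set (Fin N → ℝ)) (x ν : Fin N → ℝ) : Prop :=
  ∀ᶠ y in 𝓝 x, y ∈ F → 2 * ((y - x) ⬝ᵥ ν) ≤ (y - x) ⬝ᵥ (y - x)

/-- The vector field `X` is tangent to `F` in the sense of Bony. -/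
def TangentTo {N : ℕ} (F : Set (Fin N → ℝ)) (X : (Fin N → ℝ) → (Fin N → ℝ)) : Prop :=
  ∀ x ∈ F, ∀ ν, NormalAt F x ν → X x ⬝ᵥ ν = 0

lemma dotProduct_le_card_mul_norm {N : ℕ} (v w : Fin N → ℝ) : v ⬝ᵥ w ≤ N * (‖v‖ * ‖w‖) := by
  calc v ⬝ᵥ w ≤ ∑ _i : Fin N, ‖v‖ * ‖w‖ := by
        refine Finset.sum_le_sum fun i _ => (le_abs_self _).trans ?_
        rw [abs_mul]
        exact mul_le_mul (norm_le_pi_norm v i) (norm_le_pi_norm w i) (abs_nonneg _) (norm_nonneg _)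
    _ = N * (‖v‖ * ‖w‖) := by simp

lemma norm_sq_le_dotProduct_self {N : ℕ} (v : Fin N → ℝ) : ‖v‖ ^ 2 ≤ v ⬝ᵥ v := by
  have h0 : 0 ≤ v ⬝ᵥ v := Finset.sum_nonneg fun i _ => mul_self_nonneg _
  refine Real.le_sqrt (norm_nonneg _) h0 |>.1 ?_
  refine (pi_norm_le_iff_of_nonneg (Real.sqrt_nonneg _)).2 fun i => ?_
  refine Real.le_sqrt (norm_nonneg _) h0 |>.2 ?_
  rw [Real.norm_eq_abs, sq_abs, sq]
  exact Finset.single_le_sum (f := fun i => v i * v i) (fun j _ => mul_self_nonneg _)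
    (Finset.mem_univ i)

lemma dist_toLp_sq {N : ℕ} (v w : Fin N → ℝ) :
    dist (WithLp.toLp 2 v) (WithLp.toLp 2 w) ^ 2 = (v - w) ⬝ᵥ (v - w) := by
  rw [dist_eq_norm, EuclideanSpace.real_norm_sq_eq]
  simp [dotProduct, sq]

lemma dist_le_dist_toLp {N : ℕ} (v w : Fin N → ℝ) :
    dist v w ≤ dist (WithLp.toLp 2 v) (WithLp.toLp 2 w) := by
  refine le_of_sq_le_sq ?_ dist_nonneg
  rw [dist_toLp_sq, dist_eq_norm]
  exact norm_sq_le_dotProduct_self _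

lemma HasDerivAt.dotProduct_self {N : ℕ} {γ : ℝ → Fin N → ℝ} {v : Fin N → ℝ} {t : ℝ}
    (h : HasDerivAt γ v t) : HasDerivAt (fun s => γ s ⬝ᵥ γ s) (2 * (γ t ⬝ᵥ v)) t := by
  have h' := hasDerivAt_pi.1 h
  have : HasDerivAt (fun s => ∑ i, γ s i * γ s i) (∑ i, (v i * γ t i + γ t i * v i)) t :=
    HasDerivAt.fun_sum fun i _ => (h' i).mul (h' i)
  have e : 2 * (γ t ⬝ᵥ v) = ∑ i, (v i * γ t i + γ t i * v i) := by
    rw [dotProduct, Finset.mul_sum]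
    exact Finset.sum_congr rfl fun i _ => by ring
  rw [e]
  exact this

/-- A point `y` of `F` nearest to `p` has `p - y` as a normal vector. -/
lemma NormalAt.of_nearest {N : ℕ} {F : Set (Fin N → ℝ)} {p y : Fin N → ℝ}
    (h : ∀ᶠ z in 𝓝 y, z ∈ F → (p - y) ⬝ᵥ (p - y) ≤ (p - z) ⬝ᵥ (p - z)) :
    NormalAt F y (p - y) := by
  filter_upwards [h] with z hz hzF
  have h1 := hz hzF
  have : p - z = (p - y) - (z - y) := by abel
  rw [this, sub_dotProduct _ (z - y), dotProduct_sub (p - y) _ (z - y),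
    dotProduct_sub (z - y) _ (z - y), dotProduct_comm (p - y) (z - y)] at h1
  linarith

/-- Short-time forward invariance of `F` under the integral curves of a tangent field. -/
lemma TangentTo.eventually_mem_right {N : ℕ} {Ω F : Set (Fin N → ℝ)}
    {X : (Fin N → ℝ) → (Fin N → ℝ)} (hΩ : IsOpen Ω) (hFΩ : F ⊆ Ω) (hF : IsOpen (Ω \ F))
    (hX : ContDiffOn ℝ 1 X Ω) (hT : TangentTo F X) {γ : ℝ → Fin N → ℝ} {t₀ : ℝ}
    (h0 : γ t₀ ∈ F) (hγ : ∀ᶠ t in 𝓝 t₀, HasDerivAt γ (X (γ t)) t) :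
    ∀ᶠ t in 𝓝[≥] t₀, γ t ∈ F := by
  obtain ⟨K, s, hs, hK⟩ :=
    (hX.contDiffAt (hΩ.mem_nhds (hFΩ h0))).exists_lipschitzOnWith
  obtain ⟨ρ, hρ, hball⟩ := Metric.nhds_basis_closedBall.mem_iff.1
    (inter_mem hs (hΩ.mem_nhds (hFΩ h0)))
  set F' := F ∩ Metric.closedBall (γ t₀) ρ with hF'
  have hF'c : IsCompact F' := by
    have : F' = Metric.closedBall (γ t₀) ρ \ (Ω \ F) := by
      ext x
      simp only [hF', mem_inter_iff, Set.mem_sdiff]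
      constructor
      · rintro ⟨h1, h2⟩
        exact ⟨h2, fun h => h.2 h1⟩
      · rintro ⟨h1, h2⟩
        exact ⟨by_contra fun h => h2 ⟨(hball h1).2, h⟩, h1⟩
    rw [this]
    exact (isCompact_closedBall _ _).diff hF
  set L : (Fin N → ℝ) → EuclideanSpace ℝ (Fin N) := fun v => WithLp.toLp 2 v with hL
  have hLc : Continuous L := PiLp.continuous_toLp 2 _
  have hG : IsCompact (L '' F') := hF'c.image hLc
  have h0' : γ t₀ ∈ F' := ⟨h0, Metric.mem_closedBall_self hρ.le⟩
  have hGne : (L '' F').Nonempty := ⟨_, mem_image_of_mem L h0'⟩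
  have hnear : ∀ᶠ t in 𝓝 t₀, dist (L (γ t)) (L (γ t₀)) < ρ / 2 := by
    have : ContinuousAt (fun t => L (γ t)) t₀ :=
      hLc.continuousAt.comp hγ.self_of_nhds.continuousAt
    exact this (Metric.ball_mem_nhds _ (by positivity))
  obtain ⟨δ, hδ, hδ'⟩ := Metric.nhds_basis_closedBall.eventually_iff.1 (hγ.and hnear)
  have hI : ∀ t ∈ Icc t₀ (t₀ + δ), HasDerivAt γ (X (γ t)) t ∧
      dist (L (γ t)) (L (γ t₀)) < ρ / 2 := by
    intro t ht
    refine hδ' ?_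
    rw [Metric.mem_closedBall, Real.dist_eq, abs_le]
    constructor <;> linarith [ht.1, ht.2]
  have key : ∀ t ∈ Icc t₀ (t₀ + δ), Metric.infDist (L (γ t)) (L '' F') ^ 2
      ≤ gronwallBound 0 (2 * (N * K)) 0 (t - t₀) := by
    refine le_gronwallBound_of_liminf_deriv_right_le
      (f' := fun t => 2 * (N * K) * Metric.infDist (L (γ t)) (L '' F') ^ 2) ?_ ?_ ?_ ?_
    · intro t ht
      refine ContinuousAt.continuousWithinAt ?_
      refine ContinuousAt.pow ?_ 2
      exact (Metric.continuous_infDist_pt _).continuousAt.comp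
        (hLc.continuousAt.comp (hI t ht).1.continuousAt)
    · intro t ht r hr
      have ht' := hI t (Ico_subset_Icc_self ht)
      obtain ⟨_, ⟨y, hy, rfl⟩, hyd⟩ := hG.exists_infDist_eq_dist hGne (L (γ t))
      have hle : dist (L (γ t)) (L y) < ρ / 2 := by
        rw [← hyd]
        exact (Metric.infDist_le_dist_of_mem (mem_image_of_mem L h0')).trans_lt ht'.2
      have hγball : dist (γ t) (γ t₀) < ρ / 2 := (dist_le_dist_toLp _ _).trans_lt ht'.2
      have hyball : dist y (γ t₀) < ρ := by
        have := dist_triangle_left y (γ t₀) (γ t)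
        have h1 := (dist_le_dist_toLp (γ t) y).trans_lt hle
        linarith
      have hnorm : NormalAt F y (γ t - y) := by
        refine NormalAt.of_nearest ?_
        filter_upwards [Metric.isOpen_ball.mem_nhds hyball] with z hz hzF
        rw [← dist_toLp_sq, ← dist_toLp_sq]
        have : dist (L (γ t)) (L y) ≤ dist (L (γ t)) (L z) := by
          rw [← hyd]
          exact Metric.infDist_le_dist_of_mem
            (mem_image_of_mem L ⟨hzF, Metric.ball_subset_closedBall hz⟩)
        gcongr
      have hXy := hT y hy.1 _ hnorm
      have hder := HasDerivAt.dotProduct_self (ht'.1.sub_const y)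
      have hbound : 2 * ((γ t - y) ⬝ᵥ X (γ t)) < r := by
        refine lt_of_le_of_lt ?_ hr
        have e1 : (γ t - y) ⬝ᵥ X (γ t) = (γ t - y) ⬝ᵥ (X (γ t) - X y) := by
          rw [dotProduct_sub, dotProduct_comm _ (X y), hXy, sub_zero]
        have e2 : ‖X (γ t) - X y‖ ≤ K * ‖γ t - y‖ := by
          have := hK.dist_le_mul (γ t)
            (hball (Metric.mem_closedBall.2 (by linarith))).1 y
            (hball (Metric.mem_closedBall.2 hyball.le)).1
          rwa [dist_eq_norm, dist_eq_norm] at this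
        have e3 := norm_sq_le_dotProduct_self (γ t - y)
        rw [hyd, dist_toLp_sq, e1]
        calc 2 * ((γ t - y) ⬝ᵥ (X (γ t) - X y))
            ≤ 2 * (N * (‖γ t - y‖ * ‖X (γ t) - X y‖)) := by
              gcongr
              exact dotProduct_le_card_mul_norm _ _
          _ ≤ 2 * (N * (‖γ t - y‖ * (K * ‖γ t - y‖))) := by gcongr
          _ = 2 * (N * K) * ‖γ t - y‖ ^ 2 := by ring
          _ ≤ _ := by gcongr
      have hslope := (hasDerivAt_iff_tendsto_slope.1 hder).mono_left (nhdsGT_le_nhdsNE t)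
      refine Eventually.frequently ?_
      filter_upwards [hslope.eventually_lt_const hbound, self_mem_nhdsWithin] with z hz hzt
      refine lt_of_le_of_lt ?_ hz
      rw [slope_def_field, div_eq_inv_mul]
      have hzt' : 0 < z - t := sub_pos.2 hzt
      gcongr
      · rw [← dist_toLp_sq]
        gcongr
        · exact Metric.infDist_nonneg
        · exact Metric.infDist_le_dist_of_mem (mem_image_of_mem L hy)
      · rw [← dist_toLp_sq, hyd]
    · rw [Metric.infDist_zero_of_mem (mem_image_of_mem L h0')]
      simp
    · intro t _
      simp
  filter_upwards [Icc_mem_nhdsGE (show t₀ < t₀ + δ by linarith)] with t ht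
  have h1 := key t ht
  rw [gronwallBound_ε0_δ0] at h1
  have h2 : Metric.infDist (L (γ t)) (L '' F') = 0 := by
    have := Metric.infDist_nonneg (x := L (γ t)) (s := L '' F')
    exact pow_eq_zero_iff two_ne_zero |>.1 (le_antisymm h1 (sq_nonneg _))
  obtain ⟨y, hy, hyL⟩ := (hG.isClosed.mem_iff_infDist_zero hGne).2 h2
  have : y = γ t := (WithLp.toLp_injective 2) hyL
  exact this ▸ hy.1

lemma TangentTo.neg {N : ℕ} {F : Set (Fin N → ℝ)} {X : (Fin N → ℝ) → (Fin N → ℝ)}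
    (hT : TangentTo F X) : TangentTo F (fun x => -X x) := fun x hx ν hν => by
  rw [neg_dotProduct, hT x hx ν hν, neg_zero]

/-- Integral curves of a `C¹` field tangent to `F` that meet `F` stay in `F`. -/
lemma TangentTo.mem_of_isPreconnected {N : ℕ} {Ω F : Set (Fin N → ℝ)}
    {X : (Fin N → ℝ) → (Fin N → ℝ)} (hΩ : IsOpen Ω) (hFΩ : F ⊆ Ω) (hF : IsOpen (Ω \ F))
    (hX : ContDiffOn ℝ 1 X Ω) (hT : TangentTo F X) {I : Set ℝ} (hI : IsOpen I)
    (hIc : IsPreconnected I) {γ : ℝ → Fin N → ℝ} (hγΩ : ∀ t ∈ I, γ t ∈ Ω)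
    (hγ : ∀ t ∈ I, HasDerivAt γ (X (γ t)) t) {t₀ : ℝ} (ht₀ : t₀ ∈ I) (h0 : γ t₀ ∈ F) :
    ∀ t ∈ I, γ t ∈ F := by
  have hopen : IsOpen {t | t ∈ I ∧ γ t ∈ F} := by
    rw [isOpen_iff_mem_nhds]
    rintro t ⟨htI, htF⟩
    have hev : ∀ᶠ s in 𝓝 t, HasDerivAt γ (X (γ s)) s := by
      filter_upwards [hI.mem_nhds htI] with s hs using hγ s hs
    have hr := hT.eventually_mem_right hΩ hFΩ hF hX htF hev
    have hl : ∀ᶠ s in 𝓝[≥] (-t), γ (-s) ∈ F := by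
      refine hT.neg.eventually_mem_right (γ := fun s => γ (-s)) hΩ hFΩ hF hX.neg
        (by simpa using htF) ?_
      have : Tendsto (fun s : ℝ => -s) (𝓝 (-t)) (𝓝 t) := by
        simpa using (continuous_neg (G := ℝ)).tendsto (-t)
      filter_upwards [this.eventually hev] with s hs
      have h := HasDerivAt.scomp s hs (hasDerivAt_neg s)
      rwa [neg_one_smul] at h
    have hl' : ∀ᶠ s in 𝓝[≤] t, γ s ∈ F := by
      have : Tendsto (fun s : ℝ => -s) (𝓝[≤] t) (𝓝[≥] (-t)) := by
        refine tendsto_nhdsWithin_iff.2 ⟨?_, ?_⟩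
        · exact ((continuous_neg (G := ℝ)).tendsto t).mono_left nhdsWithin_le_nhds
        · filter_upwards [self_mem_nhdsWithin] with s hs
          simpa using hs
      simpa using this.eventually hl
    have hlr : ∀ᶠ s in 𝓝 t, γ s ∈ F := by
      rw [← nhdsLE_sup_nhdsGE]
      exact eventually_sup.2 ⟨hl', hr⟩
    filter_upwards [hI.mem_nhds htI, hlr] with s h1 h2 using ⟨h1, h2⟩
  have hopen' : IsOpen {t | t ∈ I ∧ γ t ∉ F} := by
    rw [isOpen_iff_mem_nhds]
    rintro t ⟨htI, htF⟩
    filter_upwards [hI.mem_nhds htI,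
      (hγ t htI).continuousAt (hF.mem_nhds ⟨hγΩ t htI, htF⟩)] with s h1 h2
    exact ⟨h1, h2.2⟩
  have hsub := IsPreconnected.subset_left_of_subset_union hopen hopen'
    (Set.disjoint_left.2 fun t h1 h2 => h2.2 h1.2)
    (fun t ht => (em (γ t ∈ F)).imp (fun h => ⟨ht, h⟩) (fun h => ⟨ht, h⟩))
    ⟨t₀, ht₀, ht₀, h0⟩ hIc
  exact fun t ht => (hsub ht).2

lemma ContDiffAt.exists_continuousAt_flow {E : Type*} [NormedAddCommGroup E] [NormedSpace ℝ E]
    [CompleteSpace E] {X : E → E} {x₀ : E} (hX : ContDiffAt ℝ 1 X x₀) :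
    ∃ α : E × ℝ → E, ContinuousAt α (x₀, 0) ∧ α (x₀, 0) = x₀ ∧ ∃ δ > 0, ∀ p ∈ Metric.ball x₀ δ,
      α (p, 0) = p ∧ ∀ t ∈ Ioo (-δ) δ, HasDerivAt (fun s => α (p, s)) (X (α (p, t))) t := by
  obtain ⟨ε, hε, a, r, L, K, hr, H⟩ := IsPicardLindelof.of_contDiffAt_one hX
  obtain ⟨α, h1, h2⟩ := (H 0).exists_forall_mem_closedBall_eq_hasDerivWithinAt_continuousOn
  have hr' : (0 : ℝ) < r := hr
  refine ⟨α, h2.continuousAt (prod_mem_nhds (Metric.closedBall_mem_nhds _ hr')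
    (Icc_mem_nhds (by linarith) (by linarith))),
    (h1 x₀ (Metric.mem_closedBall_self hr'.le)).1, min r ε, lt_min hr' hε, fun p hp => ?_⟩
  have hp' := h1 p (Metric.ball_subset_closedBall (Metric.ball_subset_ball (min_le_left _ _) hp))
  refine ⟨hp'.1, fun t ht => ?_⟩
  have hε' := min_le_right (r : ℝ) ε
  refine (hp'.2 t ⟨by linarith [ht.1], by linarith [ht.2]⟩).hasDerivAt
    (Icc_mem_nhds (by linarith [ht.1]) (by linarith [ht.2]))

/-- Second order expansion in time of a local flow, locally uniform in the initial point. -/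
lemma eventually_norm_flow_sub_le {E : Type*} [NormedAddCommGroup E] [NormedSpace ℝ E]
    {X : E → E} {x₀ : E} (hX : ContDiffAt ℝ 1 X x₀) {α : E × ℝ → E} (hα : ContinuousAt α (x₀, 0))
    (hα0 : α (x₀, 0) = x₀) {δ : ℝ} (hδ : 0 < δ) (hflow : ∀ p ∈ Metric.ball x₀ δ,
      α (p, 0) = p ∧ ∀ t ∈ Ioo (-δ) δ, HasDerivAt (fun s => α (p, s)) (X (α (p, t))) t)
    {η : ℝ} (hη : 0 < η) :
    ∀ᶠ q : E × ℝ in 𝓝 (x₀, 0), 0 ≤ q.2 →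
      ‖α q - q.1 - q.2 • X q.1 - (q.2 ^ 2 / 2) • fderiv ℝ X x₀ (X x₀)‖ ≤ η * q.2 ^ 2 := by
  set D := fderiv ℝ X x₀ with hD
  set B := ‖X x₀‖ + 1 with hB
  set η' := min 1 (η / (B + ‖D‖)) with hη'
  have hBD : 0 < B + ‖D‖ := by positivity
  have hη'0 : 0 < η' := lt_min one_pos (by positivity)
  have hstrict := (hX.hasStrictFDerivAt one_ne_zero).isLittleO.def hη'0
  have hcont : ∀ᶠ y in 𝓝 x₀, ‖X y - X x₀‖ ≤ η' := by
    have := hX.continuousAt.tendsto.sub_const (X x₀)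
    have h2 := this.norm
    rw [sub_self, norm_zero] at h2
    exact h2.eventually_le_const hη'0
  rw [nhds_prod_eq] at hstrict
  obtain ⟨U, hU, hUs⟩ := eventually_prod_self_iff'.1 hstrict
  have hα' : ∀ᶠ q in 𝓝 (x₀, (0 : ℝ)), α q ∈ U ∧ ‖X (α q) - X x₀‖ ≤ η' := by
    have : Tendsto α (𝓝 (x₀, 0)) (𝓝 x₀) := by simpa [ContinuousAt, hα0] using hα
    exact this.eventually ((show ∀ᶠ y in 𝓝 x₀, y ∈ U from hU).and hcont)
  obtain ⟨R, hR, hRs⟩ := Metric.eventually_nhds_iff_ball.1 hα'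
  have hρ : 0 < min R δ := lt_min hR hδ
  filter_upwards [Metric.ball_mem_nhds _ hρ] with q hq hq2
  obtain ⟨p, t⟩ := q
  simp only at hq2 ⊢
  rw [← ball_prod_same] at hq
  obtain ⟨hp, ht⟩ := hq
  simp only [Metric.mem_ball, Real.dist_eq, sub_zero, abs_of_nonneg hq2] at hp ht
  obtain ⟨h0, hd⟩ := hflow p (hp.trans_le (min_le_right _ _))
  have hin : ∀ s ∈ Icc 0 t, α (p, s) ∈ U ∧ ‖X (α (p, s)) - X x₀‖ ≤ η' := by
    intro s hs
    refine hRs _ ?_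
    rw [← ball_prod_same]
    refine ⟨hp.trans_le (min_le_left _ _), ?_⟩
    simp only [Metric.mem_ball, Real.dist_eq, sub_zero, abs_of_nonneg hs.1]
    exact hs.2.trans_lt (ht.trans_le (min_le_left _ _))
  have hder : ∀ s ∈ Icc 0 t, HasDerivAt (fun s => α (p, s)) (X (α (p, s))) s := by
    intro s hs
    have := min_le_right R δ
    exact hd s ⟨by linarith [hs.1], by linarith [hs.2]⟩
  have hB' : ∀ s ∈ Icc 0 t, ‖X (α (p, s))‖ ≤ B := by
    intro s hs
    have h1 := norm_le_norm_add_norm_sub' (X (α (p, s))) (X x₀)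
    have h2 := (hin s hs).2
    have h3 : η' ≤ 1 := min_le_left _ _
    linarith
  have e1 : ∀ s ∈ Icc 0 t, ‖α (p, s) - p‖ ≤ B * s := by
    intro s hs
    have := norm_image_sub_le_of_norm_deriv_le_segment' (f := fun s => α (p, s))
      (fun x hx => (hder x hx).hasDerivWithinAt)
      (fun x hx => hB' x (Ico_subset_Icc_self hx)) s hs
    simpa [h0] using this
  have e2 : ∀ s ∈ Icc 0 t, ‖α (p, s) - p - s • X x₀‖ ≤ η' * s := by
    intro s hs
    have := norm_image_sub_le_of_norm_deriv_le_segment' (f := fun s => α (p, s) - s • X x₀)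
      (f' := fun s => X (α (p, s)) - (1 : ℝ) • X x₀) (C := η')
      (fun x hx => ((hder x hx).sub ((hasDerivAt_id x).smul_const (X x₀))).hasDerivWithinAt)
      (fun x hx => by simpa using (hin x (Ico_subset_Icc_self hx)).2) s hs
    simp only [h0, zero_smul, sub_zero] at this
    convert this using 2
    abel
  have e3 := norm_image_sub_le_of_norm_deriv_le_segment'
      (f := fun s => α (p, s) - s • X p - (s ^ 2 / 2) • D (X x₀))
      (f' := fun s => X (α (p, s)) - (1 : ℝ) • X p - s • D (X x₀)) (C := η * t)
      (fun x hx => by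
        have hsq : HasDerivAt (fun s : ℝ => s ^ 2 / 2) x x := by
          have := (hasDerivAt_pow 2 x).div_const 2
          rwa [show ((2 : ℕ) : ℝ) * x ^ (2 - 1) / 2 = x by norm_num] at this
        exact (((hder x hx).sub ((hasDerivAt_id x).smul_const (X p))).sub
          (hsq.smul_const (D (X x₀)))).hasDerivWithinAt)
      (fun s hs => by
        have hs' := Ico_subset_Icc_self hs
        have f1 := hUs (α (p, s)) (hin s hs').1 p (by simpa [h0] using (hin 0 ⟨le_rfl, hq2⟩).1)
        have f2 := e1 s hs'
        have f3 := e2 s hs'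
        have split : X (α (p, s)) - (1 : ℝ) • X p - s • D (X x₀)
            = (X (α (p, s)) - X p - D (α (p, s) - p)) + D (α (p, s) - p - s • X x₀) := by
          simp only [map_sub, map_smul, one_smul]
          abel
        rw [split]
        calc _ ≤ ‖X (α (p, s)) - X p - D (α (p, s) - p)‖ + ‖D (α (p, s) - p - s • X x₀)‖ :=
              norm_add_le _ _
          _ ≤ η' * (B * s) + ‖D‖ * (η' * s) := by
              gcongr
              · exact f1.trans (by gcongr)
              · exact (D.le_opNorm _).trans (by gcongr)
          _ = η' * (B + ‖D‖) * s := by ring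
          _ ≤ η * s := by
              have := hs.1
              gcongr
              exact (le_div_iff₀ hBD).1 (min_le_right _ _)
          _ ≤ η * t := by
              gcongr
              exact hs.2.le) t ⟨hq2, le_rfl⟩
  simp only [h0, zero_smul, sub_zero, zero_pow, ne_eq, OfNat.ofNat_ne_zero, not_false_eq_true,
    zero_div] at e3
  calc _ = ‖α (p, t) - t • X p - (t ^ 2 / 2) • D (X x₀) - p‖ := by congr 1; abel
    _ ≤ η * t * t := e3
    _ = η * t ^ 2 := by ring

/-- Following a tangent field for a short time moves a curve in `F` to another curve in `F`, with
explicit effect on the second order expansion. -/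
lemma TangentTo.exists_flow_step {N : ℕ} {Ω F : Set (Fin N → ℝ)}
    {X : (Fin N → ℝ) → (Fin N → ℝ)} (hΩ : IsOpen Ω) (hFΩ : F ⊆ Ω) (hF : IsOpen (Ω \ F))
    (hX : ContDiffOn ℝ 1 X Ω) (hT : TangentTo F X) {x₀ : Fin N → ℝ} (hx₀ : x₀ ∈ F)
    {p : ℝ → Fin N → ℝ} {v w : Fin N → ℝ} (hp : ∀ᶠ t in 𝓝[>] (0 : ℝ), p t ∈ F)
    (hpo : (fun t => p t - x₀ - t • v - t ^ 2 • w) =o[𝓝[>] (0 : ℝ)] fun t => t ^ 2) :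
    ∃ q : ℝ → Fin N → ℝ, (∀ᶠ t in 𝓝[>] (0 : ℝ), q t ∈ F) ∧
      (fun t => q t - x₀ - t • (v + X x₀)
        - t ^ 2 • (w + fderiv ℝ X x₀ v + (1 / 2 : ℝ) • fderiv ℝ X x₀ (X x₀)))
        =o[𝓝[>] (0 : ℝ)] fun t => t ^ 2 := by
  have hXx : ContDiffAt ℝ 1 X x₀ := hX.contDiffAt (hΩ.mem_nhds (hFΩ hx₀))
  obtain ⟨α, hα, hα0, δ, hδ, hflow⟩ := hXx.exists_continuousAt_flow
  set D := fderiv ℝ X x₀ with hD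
  have ht2 : (fun t : ℝ => t ^ 2) =o[𝓝[>] (0 : ℝ)] fun t => t := by
    refine Asymptotics.IsLittleO.mono ?_ nhdsWithin_le_nhds
    simpa using Asymptotics.isLittleO_pow_id (𝕜 := ℝ) (n := 2) one_lt_two
  have hid : Tendsto (fun t : ℝ => t) (𝓝[>] 0) (𝓝 0) := tendsto_id.mono_left nhdsWithin_le_nhds
  have h1 : (fun t => p t - x₀ - t • v) =o[𝓝[>] (0 : ℝ)] fun t => t := by
    have : (fun t : ℝ => t ^ 2 • w) =O[𝓝[>] (0 : ℝ)] fun t => t ^ 2 := by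
      refine Asymptotics.IsBigO.of_bound ‖w‖ (Eventually.of_forall fun t => ?_)
      rw [norm_smul, mul_comm]
    have := (hpo.trans ht2).add (this.trans_isLittleO ht2)
    simpa using this
  have h2 : (fun t => p t - x₀) =O[𝓝[>] (0 : ℝ)] fun t => t := by
    have : (fun t : ℝ => t • v) =O[𝓝[>] (0 : ℝ)] fun t => t := by
      refine Asymptotics.IsBigO.of_bound ‖v‖ (Eventually.of_forall fun t => ?_)
      rw [norm_smul, mul_comm]
    simpa using h1.isBigO.add this
  have hptend : Tendsto p (𝓝[>] 0) (𝓝 x₀) := by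
    have := (h2.trans_tendsto hid).add_const x₀
    simpa using this
  have hq : Tendsto (fun t => (p t, t)) (𝓝[>] (0 : ℝ)) (𝓝 (x₀, 0)) := hptend.prodMk_nhds hid
  refine ⟨fun t => α (p t, t), ?_, ?_⟩
  · have hΩ' : ∀ᶠ q in 𝓝 (x₀, (0 : ℝ)), α q ∈ Ω := by
      have : Ω ∈ 𝓝 (α (x₀, 0)) := by rw [hα0]; exact hΩ.mem_nhds (hFΩ hx₀)
      exact hα this
    obtain ⟨R, hR, hRs⟩ := Metric.eventually_nhds_iff_ball.1 hΩ'
    have hρ : 0 < min R δ := lt_min hR hδ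
    filter_upwards [hq (Metric.ball_mem_nhds _ hρ), hp, self_mem_nhdsWithin] with t ht htF ht0
    rw [Set.mem_preimage, ← ball_prod_same] at ht
    have hb := ht.1
    have hb2 := ht.2
    simp only [Metric.mem_ball, Real.dist_eq, sub_zero] at hb hb2
    obtain ⟨e0, ed⟩ := hflow (p t) (hb.trans_le (min_le_right _ _))
    refine hT.mem_of_isPreconnected hΩ hFΩ hF hX (I := Ioo (-min R δ) (min R δ)) isOpen_Ioo
      isPreconnected_Ioo (γ := fun s => α (p t, s)) ?_ ?_ (t₀ := 0) ⟨by linarith, hρ⟩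
      (by simpa [e0] using htF) t (abs_lt.1 hb2)
    · intro s hs
      refine hRs _ ?_
      rw [← ball_prod_same]
      refine ⟨hb.trans_le (min_le_left _ _), ?_⟩
      simp only [Metric.mem_ball, Real.dist_eq, sub_zero]
      exact (abs_lt.2 hs).trans_le (min_le_left _ _)
    · intro s hs
      have := min_le_right R δ
      exact ed s ⟨by linarith [hs.1], by linarith [hs.2]⟩
  · have g1 : (fun t => α (p t, t) - p t - t • X (p t) - (t ^ 2 / 2) • D (X x₀))
        =o[𝓝[>] (0 : ℝ)] fun t => t ^ 2 := by
      refine Asymptotics.isLittleO_iff.2 fun η hη => ?_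
      filter_upwards [hq.eventually (eventually_norm_flow_sub_le hXx hα hα0 hδ hflow hη),
        self_mem_nhdsWithin] with t ht ht0
      rw [norm_pow, Real.norm_eq_abs, sq_abs]
      exact ht (le_of_lt ht0)
    have g2 : (fun t => X (p t) - X x₀ - D (p t - x₀)) =o[𝓝[>] (0 : ℝ)] fun t => t :=
      ((hXx.differentiableAt one_ne_zero).hasFDerivAt.isLittleO.comp_tendsto hptend).trans_isBigO h2
    have g3 : (fun t => D (p t - x₀ - t • v)) =o[𝓝[>] (0 : ℝ)] fun t => t :=
      (D.isBigO_comp _ _).trans_isLittleO h1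
    have g4 : (fun t => t • ((X (p t) - X x₀ - D (p t - x₀)) + D (p t - x₀ - t • v)))
        =o[𝓝[>] (0 : ℝ)] fun t => t ^ 2 := by
      have := (Asymptotics.isBigO_refl (fun t : ℝ => t) (𝓝[>] (0 : ℝ))).smul_isLittleO (g2.add g3)
      simpa [sq] using this
    refine ((g1.add hpo).add g4).congr_left fun t => ?_
    simp only [map_sub, map_smul]
    module

lemma lieBr_swap {N : ℕ} (X Y : (Fin N → ℝ) → (Fin N → ℝ)) (x : Fin N → ℝ) :
    lieBr Y X x = -lieBr X Y x := by
  simp [lieBr]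

lemma TangentTo.lieBr_dotProduct_nonpos {N : ℕ} {Ω F : Set (Fin N → ℝ)}
    {X Y : (Fin N → ℝ) → (Fin N → ℝ)} (hΩ : IsOpen Ω) (hFΩ : F ⊆ Ω) (hF : IsOpen (Ω \ F))
    (hX : ContDiffOn ℝ 1 X Ω) (hY : ContDiffOn ℝ 1 Y Ω) (hTX : TangentTo F X)
    (hTY : TangentTo F Y) {x ν : Fin N → ℝ} (hx : x ∈ F) (hν : NormalAt F x ν) :
    lieBr X Y x ⬝ᵥ ν ≤ 0 := by
  obtain ⟨p₁, hp₁, ho₁⟩ := hTX.exists_flow_step hΩ hFΩ hF hX hx (p := fun _ => x) (v := 0) (w := 0)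
    (Eventually.of_forall fun _ => hx) (by simp)
  obtain ⟨p₂, hp₂, ho₂⟩ := hTY.exists_flow_step hΩ hFΩ hF hY hx hp₁ ho₁
  obtain ⟨p₃, hp₃, ho₃⟩ := hTX.neg.exists_flow_step hΩ hFΩ hF hX.neg hx hp₂ ho₂
  obtain ⟨q, hq, ho⟩ := hTY.neg.exists_flow_step hΩ hFΩ hF hY.neg hx hp₃ ho₃
  have hq2 : (fun t => q t - x - t ^ 2 • lieBr X Y x) =o[𝓝[>] (0 : ℝ)] fun t => t ^ 2 := by
    refine ho.congr_left fun t => ?_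
    simp only [fderiv_fun_neg, lieBr, _root_.neg_apply, map_add, map_neg, map_zero]
    module
  have hg : Tendsto (fun t => (t ^ 2)⁻¹ • (q t - x)) (𝓝[>] (0 : ℝ)) (𝓝 (lieBr X Y x)) := by
    have := hq2.tendsto_inv_smul_nhds_zero.add_const (lieBr X Y x)
    rw [zero_add] at this
    refine this.congr' ?_
    filter_upwards [self_mem_nhdsWithin] with t ht
    have ht0 : t ^ 2 ≠ 0 := pow_ne_zero 2 (ne_of_gt ht)
    rw [smul_sub, inv_smul_smul₀ ht0, sub_add_cancel]
  have ht2 : Tendsto (fun t : ℝ => t ^ 2) (𝓝[>] 0) (𝓝 0) := by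
    have : Tendsto (fun t : ℝ => t ^ 2) (𝓝 0) (𝓝 (0 ^ 2)) := (continuous_pow 2).tendsto 0
    rw [zero_pow two_ne_zero] at this
    exact this.mono_left nhdsWithin_le_nhds
  have hqx : Tendsto q (𝓝[>] (0 : ℝ)) (𝓝 x) := by
    have := (ht2.smul hg).add_const x
    rw [zero_smul, zero_add] at this
    refine this.congr' ?_
    filter_upwards [self_mem_nhdsWithin] with t ht
    rw [smul_inv_smul₀ (pow_ne_zero 2 (ne_of_gt ht)), sub_add_cancel]
  have hdot : Continuous fun u : (Fin N → ℝ) × (Fin N → ℝ) => u.1 ⬝ᵥ u.2 := by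
    unfold dotProduct
    fun_prop
  have l1 := ((hdot.tendsto _).comp (hg.prodMk_nhds (tendsto_const_nhds (x := ν)))).const_mul 2
  have l2 := ht2.mul ((hdot.tendsto _).comp (hg.prodMk_nhds hg))
  have := le_of_tendsto_of_tendsto l1 l2 (by
    filter_upwards [hqx.eventually hν, hq, self_mem_nhdsWithin] with t h1 h2 ht
    have ht0 : 0 < t ^ 2 := pow_pos ht 2
    have h3 := h1 h2
    simp only [Function.comp_apply, smul_dotProduct, dotProduct_smul, smul_eq_mul]
    calc 2 * ((t ^ 2)⁻¹ * ((q t - x) ⬝ᵥ ν)) = (t ^ 2)⁻¹ * (2 * ((q t - x) ⬝ᵥ ν)) := by ring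
      _ ≤ (t ^ 2)⁻¹ * ((q t - x) ⬝ᵥ (q t - x)) := by gcongr
      _ = _ := by field_simp)
  simp only [zero_mul] at this
  linarith

lemma TangentTo.lieBr {N : ℕ} {Ω F : Set (Fin N → ℝ)}
    {X Y : (Fin N → ℝ) → (Fin N → ℝ)} (hΩ : IsOpen Ω) (hFΩ : F ⊆ Ω) (hF : IsOpen (Ω \ F))
    (hX : ContDiffOn ℝ 1 X Ω) (hY : ContDiffOn ℝ 1 Y Ω) (hTX : TangentTo F X)
    (hTY : TangentTo F Y) : TangentTo F (lieBr X Y) := fun x hx ν hν => by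
  refine le_antisymm (hTX.lieBr_dotProduct_nonpos hΩ hFΩ hF hX hY hTY hx hν) ?_
  have := hTY.lieBr_dotProduct_nonpos hΩ hFΩ hF hY hX hTX hx hν
  rw [lieBr_swap, neg_dotProduct] at this
  linarith

lemma ContDiffOn.lieBr {N : ℕ} {Ω : Set (Fin N → ℝ)} {X Y : (Fin N → ℝ) → (Fin N → ℝ)}
    (hΩ : IsOpen Ω) (hX : ContDiffOn ℝ (⊤ : ℕ∞) X Ω) (hY : ContDiffOn ℝ (⊤ : ℕ∞) Y Ω) :
    ContDiffOn ℝ (⊤ : ℕ∞) (lieBr X Y) Ω := by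
  have hX' := hX.fderiv_of_isOpen (m := (⊤ : ℕ∞)) hΩ (by simp)
  have hY' := hY.fderiv_of_isOpen (m := (⊤ : ℕ∞)) hΩ (by simp)
  exact (hY'.clm_apply hX).sub (hX'.clm_apply hY)

/-- The module of fields tangent to `F` contains `£(S)` as soon as it contains `S`. -/
lemma LieSpan.contDiffOn_and_tangentTo {N : ℕ} {Ω F : Set (Fin N → ℝ)}
    {S : Set ((Fin N → ℝ) → (Fin N → ℝ))} (hΩ : IsOpen Ω) (hFΩ : F ⊆ Ω) (hF : IsOpen (Ω \ F))
    (hS : ∀ X ∈ S, ContDiffOn ℝ (⊤ : ℕ∞) X Ω ∧ TangentTo F X)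
    {Z : (Fin N → ℝ) → (Fin N → ℝ)} (hZ : LieSpan Ω S Z) :
    ContDiffOn ℝ (⊤ : ℕ∞) Z Ω ∧ TangentTo F Z := by
  induction hZ with
  | base X hX => exact hS X hX
  | smul f X hf _ ih =>
    refine ⟨hf.smul ih.1, fun x hx ν hν => ?_⟩
    rw [smul_dotProduct, ih.2 x hx ν hν, smul_zero]
  | add X Y _ _ ihX ihY =>
    refine ⟨ihX.1.add ihY.1, fun x hx ν hν => ?_⟩
    rw [add_dotProduct, ihX.2 x hx ν hν, ihY.2 x hx ν hν, add_zero]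
  | bracket X Y _ _ ihX ihY =>
    have h1 : (1 : WithTop ℕ∞) ≤ (⊤ : ℕ∞) := by exact_mod_cast le_top
    exact ⟨ihX.1.lieBr hΩ ihY.1,
      ihX.2.lieBr hΩ hFΩ hF (ihX.1.of_le h1) (ihY.1.of_le h1) ihY.2⟩

lemma ContDiffOn.vApp {N : ℕ} {Ω : Set (Fin N → ℝ)} {X : (Fin N → ℝ) → (Fin N → ℝ)}
    {f : (Fin N → ℝ) → ℝ} (hΩ : IsOpen Ω) (hX : ContDiffOn ℝ (⊤ : ℕ∞) X Ω)
    (hf : ContDiffOn ℝ (⊤ : ℕ∞) f Ω) : ContDiffOn ℝ (⊤ : ℕ∞) (vApp X f) Ω :=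
  (hf.fderiv_of_isOpen (m := (⊤ : ℕ∞)) hΩ (by simp)).clm_apply hX

lemma vApp_vApp {N : ℕ} {X Y : (Fin N → ℝ) → (Fin N → ℝ)} {f : (Fin N → ℝ) → ℝ}
    {x : Fin N → ℝ} (hf : ContDiffAt ℝ 2 f x) (hY : DifferentiableAt ℝ Y x) :
    vApp X (vApp Y f) x
      = fderiv ℝ (fderiv ℝ f) x (X x) (Y x) + fderiv ℝ f x (fderiv ℝ Y x (X x)) := by
  have hf' : DifferentiableAt ℝ (fderiv ℝ f) x :=
    (hf.fderiv_right (m := 1) (by norm_num)).differentiableAt one_ne_zero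
  have := (hf'.hasFDerivAt.clm_apply hY.hasFDerivAt).fderiv
  change fderiv ℝ (fun y => fderiv ℝ f y (Y y)) x (X x) = _
  rw [this]
  simp [add_comm]

lemma IsLocalMax.fderiv_fderiv_apply_self_nonpos {E : Type*} [NormedAddCommGroup E]
    [NormedSpace ℝ E] {h : E → ℝ} {y : E} (hm : IsLocalMax h y) (hh : ContDiffAt ℝ 2 h y) (v : E) :
    fderiv ℝ (fderiv ℝ h) y v v ≤ 0 := by
  by_contra! hpos
  set ℓ : ℝ → E := fun t => y + t • v with hℓ
  have hℓ0 : ℓ 0 = y := by simp [hℓ]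
  have hℓd : ∀ t, HasDerivAt ℓ v t := fun t => by
    have h1 := ((hasDerivAt_id t).smul_const v).const_add y
    rwa [one_smul] at h1
  have hℓc : Tendsto ℓ (𝓝 0) (𝓝 y) := by simpa [hℓ0] using (hℓd 0).continuousAt.tendsto
  have hd1 : ∀ᶠ t in 𝓝 (0 : ℝ), HasDerivAt (fun s => h (ℓ s)) (fderiv ℝ h (ℓ t) v) t := by
    have : ∀ᶠ z in 𝓝 y, DifferentiableAt ℝ h z :=
      (hh.eventually (by simp)).mono fun z hz => hz.differentiableAt two_ne_zero
    filter_upwards [hℓc.eventually this] with t ht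
    exact ht.hasFDerivAt.comp_hasDerivAt t (hℓd t)
  have hderiv : deriv (fun s => h (ℓ s)) =ᶠ[𝓝 0] fun t => fderiv ℝ h (ℓ t) v :=
    hd1.mono fun t ht => ht.deriv
  have hf' : HasFDerivAt (fderiv ℝ h) (fderiv ℝ (fderiv ℝ h) y) (ℓ 0) := by
    rw [hℓ0]
    exact ((hh.fderiv_right (m := 1) (by norm_num)).differentiableAt one_ne_zero).hasFDerivAt
  have hd2 : HasDerivAt (fun t => fderiv ℝ h (ℓ t) v) (fderiv ℝ (fderiv ℝ h) y v v) 0 := by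
    have := (hf'.comp_hasDerivAt 0 (hℓd 0)).clm_apply (hasDerivAt_const 0 v)
    simpa using this
  have hdd : deriv (deriv fun s => h (ℓ s)) 0 = fderiv ℝ (fderiv ℝ h) y v v :=
    hderiv.deriv_eq.trans hd2.deriv
  have hd0 : deriv (fun s => h (ℓ s)) 0 = 0 := by
    rw [hderiv.self_of_nhds]
    change fderiv ℝ h (ℓ 0) v = 0
    rw [hℓ0, hm.fderiv_eq_zero]
    rfl
  have hmin := isLocalMin_of_deriv_deriv_pos (by rw [hdd]; exact hpos) hd0
    hd1.self_of_nhds.continuousAt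
  have hmax : ∀ᶠ t in 𝓝 (0 : ℝ), h (ℓ t) ≤ h (ℓ 0) := by
    rw [hℓ0]
    exact hℓc.eventually hm
  have hconst : (fun s => h (ℓ s)) =ᶠ[𝓝 0] fun _ => h (ℓ 0) := by
    filter_upwards [hmin, hmax] with t h1 h2 using le_antisymm h2 h1
  have := hconst.deriv.deriv_eq
  rw [hdd] at this
  simp at this
  exact hpos.ne' this

lemma sum_mul_apply_apply_nonpos {N : ℕ} {A : Matrix (Fin N) (Fin N) ℝ}
    (hA : ∀ i j, A i j = A j i) (hA0 : ∀ ξ : Fin N → ℝ, 0 ≤ ∑ i, ∑ j, A i j * ξ i * ξ j)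
    {E : Type*} [NormedAddCommGroup E] [NormedSpace ℝ E] {B : E →L[ℝ] E →L[ℝ] ℝ}
    (hB : ∀ v, B v v ≤ 0) (e : Fin N → E) : ∑ i, ∑ j, A i j * B (e i) (e j) ≤ 0 := by
  have hpsd : A.PosSemidef := by
    refine Matrix.PosSemidef.of_dotProduct_mulVec_nonneg ?_ fun ξ => ?_
    · ext i j
      simp [hA i j]
    · refine (hA0 ξ).trans_eq ?_
      simp only [dotProduct, Matrix.mulVec, star_trivial, Finset.mul_sum]
      exact Finset.sum_congr rfl fun i _ => Finset.sum_congr rfl fun j _ => by ring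
  obtain ⟨m, v, rfl⟩ := Matrix.posSemidef_iff_eq_sum_vecMulVec.1 hpsd
  have : ∑ i, ∑ j, (∑ k, Matrix.vecMulVec (v k) (star (v k))) i j * B (e i) (e j)
      = ∑ k, B (∑ i, v k i • e i) (∑ j, v k j • e j) := by
    have hB' : ∀ k, B (∑ i, v k i • e i) (∑ j, v k j • e j)
        = ∑ i, ∑ j, v k i * v k j * B (e i) (e j) := fun k => by
      simp only [map_sum, map_smul, _root_.sum_apply, _root_.smul_apply, smul_eq_mul,
        Finset.mul_sum]
      rw [Finset.sum_comm]
      exact Finset.sum_congr rfl fun i _ => Finset.sum_congr rfl fun j _ => by ring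
    simp only [hB', Matrix.sum_apply, Matrix.vecMulVec_apply, star_trivial, Finset.sum_mul]
    refine (Finset.sum_congr rfl fun i _ => ?_).trans Finset.sum_comm
    rw [Finset.sum_comm]
  rw [this]
  exact Finset.sum_nonpos fun k _ => hB _

/-- The Euclidean inner product on `Fin N → ℝ` as a continuous bilinear form. -/
def dotCLM (N : ℕ) : (Fin N → ℝ) →L[ℝ] (Fin N → ℝ) →L[ℝ] ℝ :=
  ∑ i, (ContinuousLinearMap.proj (R := ℝ) (φ := fun _ : Fin N => ℝ) i).smulRight
    (ContinuousLinearMap.proj (R := ℝ) (φ := fun _ : Fin N => ℝ) i)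

lemma dotCLM_apply {N : ℕ} (u v : Fin N → ℝ) : dotCLM N u v = u ⬝ᵥ v := by
  simp [dotCLM, dotProduct]

/-- The Gaussian barrier centred at `c`. -/
def gauss {N : ℕ} (α : ℝ) (c y : Fin N → ℝ) : ℝ := Real.exp (-(α * ((y - c) ⬝ᵥ (y - c))))

lemma hasFDerivAt_gauss {N : ℕ} (α : ℝ) (c y : Fin N → ℝ) :
    HasFDerivAt (gauss α c) ((-(2 * α) * gauss α c y) • dotCLM N (y - c)) y := by
  have h1 : HasFDerivAt (fun y : Fin N → ℝ => y - c) (ContinuousLinearMap.id ℝ _) y :=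
    (hasFDerivAt_id y).sub_const c
  have h2 := ((((dotCLM N).hasFDerivAt.comp y h1).clm_apply h1).const_mul α).neg.exp
  have h3 : gauss α c = fun y => Real.exp (-(α * dotCLM N (y - c) (y - c))) := by
    funext y
    rw [dotCLM_apply, gauss]
  rw [h3]
  refine h2.congr_fderiv ?_
  ext v
  simp [dotCLM_apply, dotProduct_comm v]
  ring

lemma contDiff_gauss {N : ℕ} (α : ℝ) (c : Fin N → ℝ) : ContDiff ℝ 2 (gauss α c) := by
  unfold gauss dotProduct
  fun_prop

lemma fderiv_gauss_apply {N : ℕ} (α : ℝ) (c y v : Fin N → ℝ) :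
    fderiv ℝ (gauss α c) y v = -(2 * α) * gauss α c y * ((y - c) ⬝ᵥ v) := by
  rw [(hasFDerivAt_gauss α c y).fderiv]
  simp [dotCLM_apply]

lemma fderiv_fderiv_gauss_apply {N : ℕ} (α : ℝ) (c y u v : Fin N → ℝ) :
    fderiv ℝ (fderiv ℝ (gauss α c)) y u v
      = gauss α c y * (4 * α ^ 2 * (((y - c) ⬝ᵥ u) * ((y - c) ⬝ᵥ v)) - 2 * α * (u ⬝ᵥ v)) := by
  have h0 : fderiv ℝ (gauss α c)
      = fun y => (-(2 * α) * gauss α c y) • dotCLM N (y - c) :=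
    funext fun y => (hasFDerivAt_gauss α c y).fderiv
  have h1 : HasFDerivAt (fun y : Fin N → ℝ => y - c) (ContinuousLinearMap.id ℝ _) y :=
    (hasFDerivAt_id y).sub_const c
  have h2 : HasFDerivAt (fun y => (-(2 * α) * gauss α c y) • dotCLM N (y - c)) _ y :=
    ((hasFDerivAt_gauss α c y).const_mul (-(2 * α))).smul ((dotCLM N).hasFDerivAt.comp y h1)
  rw [h0, h2.fderiv]
  simp [dotCLM_apply]
  ring

lemma fderiv_fderiv_sq_apply {E : Type*} [NormedAddCommGroup E] [NormedSpace ℝ E]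
    (ℓ : E →L[ℝ] ℝ) (x y u v : E) :
    fderiv ℝ (fderiv ℝ fun y => ℓ (y - x) ^ 2) y u v = 2 * ℓ u * ℓ v := by
  have hd : ∀ y, HasFDerivAt (fun y => ℓ (y - x)) ℓ y := fun y => by
    have h1 := ℓ.hasFDerivAt.comp y ((hasFDerivAt_id y).sub_const x)
    rwa [ContinuousLinearMap.comp_id] at h1
  have h0 : (fderiv ℝ fun y => ℓ (y - x) ^ 2) = fun y => (2 * ℓ (y - x)) • ℓ :=
    funext fun y => by simpa using ((hd y).pow 2).fderiv
  rw [h0, (((hd y).const_mul 2).smul_const ℓ).fderiv]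
  simp

lemma fderiv_sq_apply_self {E : Type*} [NormedAddCommGroup E] [NormedSpace ℝ E]
    (ℓ : E →L[ℝ] ℝ) (x : E) : (fderiv ℝ fun y => ℓ (y - x) ^ 2) x = 0 := by
  have hd : HasFDerivAt (fun y => ℓ (y - x)) ℓ x := by
    have h1 := ℓ.hasFDerivAt.comp x ((hasFDerivAt_id x).sub_const x)
    rwa [ContinuousLinearMap.comp_id] at h1
  simpa using (hd.pow 2).fderiv

/-- Equality of second order operators forces equality of their principal symbols. -/
lemma sum_mul_dotProduct_eq_of_forall_vApp {N r : ℕ} {A : Matrix (Fin N) (Fin N) ℝ}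
    {e : Fin N → (Fin N → ℝ) → (Fin N → ℝ)} {X : Fin r → (Fin N → ℝ) → (Fin N → ℝ)}
    {Y : (Fin N → ℝ) → (Fin N → ℝ)} {x : Fin N → ℝ} (he : ∀ i, DifferentiableAt ℝ (e i) x)
    (hX : ∀ k, DifferentiableAt ℝ (X k) x)
    (h : ∀ f : (Fin N → ℝ) → ℝ, ContDiff ℝ 2 f →
      (∑ i, ∑ j, A i j * vApp (e i) (vApp (e j) f) x)
        = (∑ k, vApp (X k) (vApp (X k) f) x) + vApp Y f x) (ν : Fin N → ℝ) :
    ∑ i, ∑ j, A i j * ((ν ⬝ᵥ e i x) * (ν ⬝ᵥ e j x)) = ∑ k, (ν ⬝ᵥ X k x) ^ 2 := by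
  have hf : ContDiff ℝ 2 fun y => dotCLM N ν (y - x) ^ 2 := by fun_prop
  have h1 := h _ hf
  simp only [vApp_vApp hf.contDiffAt (he _), vApp_vApp hf.contDiffAt (hX _)] at h1
  simp only [fderiv_fderiv_sq_apply, fderiv_sq_apply_self, vApp, _root_.zero_apply, add_zero] at h1
  simp only [dotCLM_apply] at h1
  have h2 : ∑ i, ∑ j, A i j * (2 * (ν ⬝ᵥ e i x) * (ν ⬝ᵥ e j x))
      = 2 * ∑ i, ∑ j, A i j * ((ν ⬝ᵥ e i x) * (ν ⬝ᵥ e j x)) := by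
    simp only [Finset.mul_sum]
    exact Finset.sum_congr rfl fun i _ => Finset.sum_congr rfl fun j _ => by ring
  have h3 : ∑ k, 2 * (ν ⬝ᵥ X k x) * (ν ⬝ᵥ X k x) = 2 * ∑ k, (ν ⬝ᵥ X k x) ^ 2 := by
    simp only [Finset.mul_sum]
    exact Finset.sum_congr rfl fun i _ => by ring
  linarith

lemma IsLocalMax.sum_mul_vApp_vApp_nonpos {N : ℕ} {A : Matrix (Fin N) (Fin N) ℝ}
    (hA : ∀ i j, A i j = A j i) (hA0 : ∀ ξ : Fin N → ℝ, 0 ≤ ∑ i, ∑ j, A i j * ξ i * ξ j)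
    {e : Fin N → (Fin N → ℝ) → (Fin N → ℝ)} {h : (Fin N → ℝ) → ℝ} {y : Fin N → ℝ}
    (hm : IsLocalMax h y) (hh : ContDiffAt ℝ 2 h y) (he : ∀ i, DifferentiableAt ℝ (e i) y) :
    ∑ i, ∑ j, A i j * vApp (e i) (vApp (e j) h) y ≤ 0 := by
  simp only [vApp_vApp hh (he _), hm.fderiv_eq_zero, _root_.zero_apply, add_zero]
  exact sum_mul_apply_apply_nonpos hA hA0 (hm.fderiv_fderiv_apply_self_nonpos hh) fun i => e i y

lemma vApp_vApp_sub_add_const_mul {N : ℕ} {X Y : (Fin N → ℝ) → (Fin N → ℝ)}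
    {f₁ f₂ g : (Fin N → ℝ) → ℝ} {y : Fin N → ℝ} (h₁ : ContDiffAt ℝ 2 f₁ y)
    (h₂ : ContDiffAt ℝ 2 f₂ y) (hg : ContDiffAt ℝ 2 g y) (hY : DifferentiableAt ℝ Y y) (ε : ℝ) :
    vApp X (vApp Y fun y => f₁ y - f₂ y + ε * g y) y
      = vApp X (vApp Y f₁) y - vApp X (vApp Y f₂) y + ε * vApp X (vApp Y g) y := by
  have hd : ∀ {f : (Fin N → ℝ) → ℝ}, ContDiffAt ℝ 2 f y →
      ∀ᶠ z in 𝓝 y, DifferentiableAt ℝ f z := fun hf =>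
    (hf.eventually (by simp)).mono fun z hz => hz.differentiableAt two_ne_zero
  have hd' : ∀ {f : (Fin N → ℝ) → ℝ}, ContDiffAt ℝ 2 f y → DifferentiableAt ℝ (vApp Y f) y :=
    fun hf => (((hf.fderiv_right (m := 1) (by norm_num)).differentiableAt
      one_ne_zero).clm_apply hY)
  have h0 : (vApp Y fun y => f₁ y - f₂ y + ε * g y)
      =ᶠ[𝓝 y] fun z => vApp Y f₁ z - vApp Y f₂ z + ε * vApp Y g z := by
    filter_upwards [hd h₁, hd h₂, hd hg] with z k₁ k₂ kg
    have := ((k₁.hasFDerivAt.sub k₂.hasFDerivAt).add (kg.hasFDerivAt.const_mul ε)).fderiv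
    change fderiv ℝ (f₁ - f₂ + fun y => ε * g y) z (Y z) = _
    rw [this]
    simp [vApp]
  have h3 := (((hd' h₁).hasFDerivAt.sub (hd' h₂).hasFDerivAt).add
    ((hd' hg).hasFDerivAt.const_mul ε)).fderiv
  change fderiv ℝ _ y (X y) = _
  rw [h0.fderiv_eq]
  change fderiv ℝ (vApp Y f₁ - vApp Y f₂ + fun y => ε * vApp Y g y) y (X y) = _
  rw [h3]
  simp [vApp]

lemma sum_mul_vApp_vApp_gauss {N : ℕ} (A : Matrix (Fin N) (Fin N) ℝ)
    {e : Fin N → (Fin N → ℝ) → (Fin N → ℝ)} {y : Fin N → ℝ}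
    (he : ∀ i, DifferentiableAt ℝ (e i) y) (α : ℝ) (c : Fin N → ℝ) :
    ∑ i, ∑ j, A i j * vApp (e i) (vApp (e j) (gauss α c)) y
      = gauss α c y * (4 * α ^ 2 * (∑ i, ∑ j, A i j * (((y - c) ⬝ᵥ e i y) * ((y - c) ⬝ᵥ e j y)))
        - 2 * α * ∑ i, ∑ j, A i j *
          (e i y ⬝ᵥ e j y + (y - c) ⬝ᵥ fderiv ℝ (e j) y (e i y))) := by
  simp only [vApp_vApp (contDiff_gauss α c).contDiffAt (he _), fderiv_fderiv_gauss_apply,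
    fderiv_gauss_apply, Finset.mul_sum, ← Finset.sum_sub_distrib]
  exact Finset.sum_congr rfl fun i _ => Finset.sum_congr rfl fun j _ => by ring

lemma gauss_pos {N : ℕ} (α : ℝ) (c y : Fin N → ℝ) : 0 < gauss α c y := Real.exp_pos _

lemma gauss_le_one {N : ℕ} {α : ℝ} (hα : 0 ≤ α) (c y : Fin N → ℝ) : gauss α c y ≤ 1 := by
  refine Real.exp_le_one_iff.2 (neg_nonpos.2 (mul_nonneg hα ?_))
  simpa using dotProduct_star_self_nonneg (y - c)

/-- If `φ - ψ + ε * gauss α c` has a local maximum close to a noncharacteristic point, where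
`φ - ψ` is not too negative, then `α` cannot be large. -/
lemma barrier_inequality {N : ℕ} {Ω : Set (Fin N → ℝ)} (hΩ : IsOpen Ω)
    {e : Fin N → (Fin N → ℝ) → (Fin N → ℝ)} (he : ∀ i, ContDiffOn ℝ (⊤ : ℕ∞) (e i) Ω)
    {a : (Fin N → ℝ) → (Fin N → ℝ) → Matrix (Fin N) (Fin N) ℝ}
    {b : (Fin N → ℝ) → ℝ → (Fin N → ℝ) → ℝ}
    (ha : ∀ i j, ContDiffOn ℝ (⊤ : ℕ∞)
      (fun q : (Fin N → ℝ) × (Fin N → ℝ) => a q.1 q.2 i j) (Ω ×ˢ (Set.univ : Set (Fin N → ℝ))))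
    (hb : ContDiffOn ℝ (⊤ : ℕ∞) (fun q : (Fin N → ℝ) × ℝ × (Fin N → ℝ) => b q.1 q.2.1 q.2.2)
      (Ω ×ˢ (Set.univ : Set (ℝ × (Fin N → ℝ)))))
    {φ ψ : (Fin N → ℝ) → ℝ} (hφ : ContDiffOn ℝ (⊤ : ℕ∞) φ Ω) (hψ : ContDiffOn ℝ (⊤ : ℕ∞) ψ Ω)
    (hQ : ∀ x ∈ Ω, Qop' N e a b ψ x ≤ Qop' N e a b φ x)
    (hsym : ∀ x p i j, a x p i j = a x p j i)
    (hnonneg : ∀ x p (ξ : Fin N → ℝ), 0 ≤ ∑ i, ∑ j, a x p i j * ξ i * ξ j)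
    (hbz : ∀ x z p, deriv (fun t : ℝ => b x t p) z ≤ 0)
    {x₀ : Fin N → ℝ} (hx₀ : x₀ ∈ Ω) (hd : fderiv ℝ φ x₀ = fderiv ℝ ψ x₀) (c : Fin N → ℝ)
    (hpos : 0 < ∑ i, ∑ j, a x₀ (fun k => vApp (e k) φ x₀) i j *
      (((x₀ - c) ⬝ᵥ e i x₀) * ((x₀ - c) ⬝ᵥ e j x₀))) :
    ∃ A > 0, ∃ C : ℝ, ∃ s₀ > 0, ∀ᶠ y in 𝓝 x₀, ∀ α ε : ℝ, 0 < α → 0 < ε → ε < s₀ →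
      IsLocalMax (fun y => φ y - ψ y + ε * gauss α c y) y →
      -(ε * gauss α c y) ≤ φ y - ψ y → α ^ 2 * A ≤ C * (1 + α) := by
  set p : (Fin N → ℝ) → (Fin N → ℝ) := fun y k => vApp (e k) φ y with hp
  set q : (Fin N → ℝ) → (Fin N → ℝ) := fun y k => vApp (e k) ψ y with hq
  have hnhds : ∀ {y}, y ∈ Ω → Ω ∈ 𝓝 y := fun hy => hΩ.mem_nhds hy
  have hpc : ContinuousAt p x₀ := continuousAt_pi.2 fun k =>
    (((he k).vApp hΩ hφ).contDiffAt (hnhds hx₀)).continuousAt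
  have hqc : ContinuousAt q x₀ := continuousAt_pi.2 fun k =>
    (((he k).vApp hΩ hψ).contDiffAt (hnhds hx₀)).continuousAt
  have hpq : p x₀ = q x₀ := funext fun k => by simp only [hp, hq, vApp, hd]
  have hψc : ContinuousAt ψ x₀ := (hψ.contDiffAt (hnhds hx₀)).continuousAt
  have hec : ∀ i, ContinuousAt (e i) x₀ := fun i =>
    ((he i).contDiffAt (hnhds hx₀)).continuousAt
  have hdec : ∀ i, ContinuousAt (fderiv ℝ (e i)) x₀ := fun i =>
    (((he i).contDiffAt (hnhds hx₀)).fderiv_right (m := (⊤ : ℕ∞)) (by simp)).continuousAt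
  have hac : ∀ i j, ContinuousAt (fun y => a y (p y) i j) x₀ := fun i j =>
    ContinuousAt.comp (f := fun y => (y, p y))
      (g := fun q : (Fin N → ℝ) × (Fin N → ℝ) => a q.1 q.2 i j)
      (((ha i j).contDiffAt ((hΩ.prod isOpen_univ).mem_nhds ⟨hx₀, trivial⟩)).continuousAt)
      (continuousAt_id.prodMk hpc)
  have hdot : ∀ {f g : (Fin N → ℝ) → (Fin N → ℝ)}, ContinuousAt f x₀ → ContinuousAt g x₀ →
      ContinuousAt (fun y => f y ⬝ᵥ g y) x₀ := fun hf hg => by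
    exact tendsto_finsetSum _ fun i _ => ((continuousAt_pi.1 hf i).mul (continuousAt_pi.1 hg i))
  have hzc : ContinuousAt (fun y : Fin N → ℝ => y - c) x₀ := by fun_prop
  -- the second order terms of the barrier
  set A : (Fin N → ℝ) → ℝ := fun y => ∑ i, ∑ j, a y (p y) i j *
    (((y - c) ⬝ᵥ e i y) * ((y - c) ⬝ᵥ e j y)) with hAdef
  set K : (Fin N → ℝ) → ℝ := fun y => ∑ i, ∑ j, a y (p y) i j *
    (e i y ⬝ᵥ e j y + (y - c) ⬝ᵥ fderiv ℝ (e j) y (e i y)) with hKdef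
  set B : (Fin N → ℝ) → (Fin N → ℝ) := fun y k => (y - c) ⬝ᵥ e k y with hBdef
  have hAc : ContinuousAt A x₀ := by
    refine tendsto_finsetSum _ fun i _ => tendsto_finsetSum _ fun j _ => ?_
    exact (hac i j).mul ((hdot hzc (hec i)).mul (hdot hzc (hec j)))
  have hKc : ContinuousAt K x₀ := by
    refine tendsto_finsetSum _ fun i _ => tendsto_finsetSum _ fun j _ => ?_
    exact (hac i j).mul ((hdot (hec i) (hec j)).add
      (hdot hzc ((hdec j).clm_apply (hec i))))
  have hBc : ContinuousAt B x₀ := continuousAt_pi.2 fun k => hdot hzc (hec k)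
  -- the lower order terms
  set G : (Fin N → ℝ) × ℝ × (Fin N → ℝ) → ℝ := fun w =>
    (∑ i, ∑ j, a w.1 w.2.2 i j * vApp (e i) (vApp (e j) ψ) w.1) + b w.1 w.2.1 w.2.2 with hG
  have hGs : ContDiffOn ℝ (⊤ : ℕ∞) G (Ω ×ˢ (Set.univ : Set (ℝ × (Fin N → ℝ)))) := by
    refine ContDiffOn.add (ContDiffOn.sum fun i _ => ContDiffOn.sum fun j _ => ?_) hb
    refine ContDiffOn.mul ?_ ?_
    · exact (ha i j).comp (f := fun w : (Fin N → ℝ) × ℝ × (Fin N → ℝ) => (w.1, w.2.2))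
        (by fun_prop) fun w hw => ⟨hw.1, trivial⟩
    · exact ((he i).vApp hΩ ((he j).vApp hΩ hψ)).comp contDiffOn_fst fun w hw => hw.1
  have hG1 : ContDiffAt ℝ 1 G (x₀, ψ x₀, p x₀) :=
    (hGs.contDiffAt ((hΩ.prod isOpen_univ).mem_nhds ⟨hx₀, trivial⟩)).of_le (by simp)
  have hGanti : ∀ y ∈ Ω, ∀ r, Antitone fun t => G (y, t, r) := by
    intro y hy r
    suffices h0 : Antitone fun t => b y t r from
      fun s t hst => add_le_add_right (h0 hst) _
    refine
      antitone_of_deriv_nonpos (fun t => ?_) fun t => hbz y t r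
    have h1 : DifferentiableAt ℝ (fun q : (Fin N → ℝ) × ℝ × (Fin N → ℝ) => b q.1 q.2.1 q.2.2)
        (y, t, r) := (hb.contDiffAt ((hΩ.prod isOpen_univ).mem_nhds ⟨hy, trivial⟩)).differentiableAt
      (by simp)
    exact h1.comp t (f := fun t => (y, t, r)) (by fun_prop)
  obtain ⟨L, U, hU, hL⟩ := hG1.exists_lipschitzOnWith
  have hU1 : ∀ᶠ y in 𝓝 x₀, (y, ψ y, q y) ∈ U := by
    have : Tendsto (fun y => (y, ψ y, q y)) (𝓝 x₀) (𝓝 (x₀, ψ x₀, p x₀)) := by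
      rw [hpq]
      exact (continuousAt_id.prodMk (hψc.prodMk hqc))
    exact this hU
  have hU2 : ∀ᶠ w in 𝓝 x₀ ×ˢ 𝓝 (0 : ℝ), (w.1, ψ w.1 - w.2, p w.1) ∈ U := by
    have h2 : Tendsto (fun w : (Fin N → ℝ) × ℝ => (w.1, ψ w.1 - w.2, p w.1))
        (𝓝 x₀ ×ˢ 𝓝 0) (𝓝 (x₀, ψ x₀ - 0, p x₀)) :=
      tendsto_fst.prodMk_nhds (((hψc.tendsto.comp tendsto_fst).sub tendsto_snd).prodMk_nhds
        (hpc.tendsto.comp tendsto_fst))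
    rw [sub_zero] at h2
    exact h2 hU
  obtain ⟨P₁, hP₁, P₂, hP₂, hP⟩ := eventually_prod_iff.1 hU2
  obtain ⟨s₀, hs₀, hs⟩ := Metric.eventually_nhds_iff.1 hP₂
  refine ⟨2 * A x₀, by positivity, 2 * (|K x₀| + 1) + L + 2 * L * (‖B x₀‖ + 1), s₀, hs₀, ?_⟩
  have hA1 : ∀ᶠ y in 𝓝 x₀, A x₀ / 2 < A y := hAc.eventually (lt_mem_nhds (by linarith [hpos]))
  have hK1 : ∀ᶠ y in 𝓝 x₀, K y < |K x₀| + 1 :=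
    hKc.eventually (gt_mem_nhds (by linarith [le_abs_self (K x₀)]))
  have hB1 : ∀ᶠ y in 𝓝 x₀, ‖B y‖ < ‖B x₀‖ + 1 :=
    hBc.norm.eventually (gt_mem_nhds (by linarith))
  filter_upwards [hA1, hK1, hB1, hU1, hP₁, hΩ.mem_nhds hx₀] with y hAy hKy hBy hUy hPy hy
    α ε hα hε hεs hmax hge
  set E := gauss α c y with hE
  have hE0 : 0 < E := gauss_pos α c y
  have h2le : (2 : WithTop ℕ∞) ≤ (⊤ : ℕ∞) := WithTop.coe_le_coe.2 (le_top : (2 : ℕ∞) ≤ ⊤)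
  have hφy : ContDiffAt ℝ 2 φ y := (hφ.contDiffAt (hnhds hy)).of_le h2le
  have hψy : ContDiffAt ℝ 2 ψ y := (hψ.contDiffAt (hnhds hy)).of_le h2le
  have hgy : ContDiffAt ℝ 2 (gauss α c) y := (contDiff_gauss α c).contDiffAt
  have hey : ∀ i, DifferentiableAt ℝ (e i) y := fun i =>
    ((he i).contDiffAt (hnhds hy)).differentiableAt (by simp)
  have hpq' : p y - q y = (2 * α * ε * E) • B y := by
    have h1 := (((hφy.differentiableAt two_ne_zero).hasFDerivAt.sub
      (hψy.differentiableAt two_ne_zero).hasFDerivAt).add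
      ((hgy.differentiableAt two_ne_zero).hasFDerivAt.const_mul ε)).fderiv
    have h2 : fderiv ℝ (φ - ψ + fun y => ε * gauss α c y) y = 0 := hmax.fderiv_eq_zero
    rw [h2] at h1
    ext k
    have h3 := congrArg (fun T : (Fin N → ℝ) →L[ℝ] ℝ => T (e k y)) h1
    simp only [_root_.zero_apply, _root_.add_apply, _root_.sub_apply, _root_.smul_apply,
      smul_eq_mul, fderiv_gauss_apply] at h3
    simp only [hp, hq, hBdef, vApp, Pi.sub_apply, Pi.smul_apply, smul_eq_mul]
    linarith
  have hpqn : dist (p y) (q y) ≤ 2 * α * ε * E * (‖B x₀‖ + 1) := by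
    rw [dist_eq_norm, hpq', norm_smul, Real.norm_of_nonneg (by positivity)]
    gcongr
  have hsecond := hmax.sum_mul_vApp_vApp_nonpos (hsym y (p y)) (hnonneg y (p y))
    ((hφy.sub hψy).add (contDiffAt_const.mul hgy)) hey
  simp only [vApp_vApp_sub_add_const_mul hφy hψy hgy (hey _)] at hsecond
  have hsplit : ∑ i, ∑ j, a y (p y) i j * (vApp (e i) (vApp (e j) φ) y
        - vApp (e i) (vApp (e j) ψ) y + ε * vApp (e i) (vApp (e j) (gauss α c)) y)
      = ∑ i, ∑ j, a y (p y) i j * vApp (e i) (vApp (e j) φ) y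
        - ∑ i, ∑ j, a y (p y) i j * vApp (e i) (vApp (e j) ψ) y
        + ε * (E * (4 * α ^ 2 * A y - 2 * α * K y)) := by
    rw [hE, ← sum_mul_vApp_vApp_gauss _ hey]
    simp only [Finset.mul_sum, ← Finset.sum_sub_distrib, ← Finset.sum_add_distrib]
    exact Finset.sum_congr rfl fun i _ => Finset.sum_congr rfl fun j _ => by ring
  rw [hsplit] at hsecond
  have hQy : G (y, ψ y, q y) ≤ ∑ i, ∑ j, a y (p y) i j * vApp (e i) (vApp (e j) φ) y
      - ∑ i, ∑ j, a y (p y) i j * vApp (e i) (vApp (e j) ψ) y + G (y, φ y, p y) := by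
    refine (hQ y hy).trans_eq ?_
    simp only [Qop', hG]
    ring
  have hanti : G (y, φ y, p y) ≤ G (y, ψ y - ε * E, p y) :=
    hGanti y hy (p y) (by linarith)
  have hεE : ε * E < s₀ := by
    nlinarith [gauss_le_one hα.le c y]
  have hU3 : (y, ψ y - ε * E, p y) ∈ U := hP hPy (hs (by
    rw [Real.dist_eq, sub_zero, abs_of_pos (by positivity)]
    exact hεE))
  have hlip := hL.dist_le_mul _ hU3 _ hUy
  have hdist : dist (y, ψ y - ε * E, p y) (y, ψ y, q y)
      ≤ ε * E + 2 * α * ε * E * (‖B x₀‖ + 1) := by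
    have h0 : 0 ≤ ε * E := by positivity
    have h1 : 0 ≤ 2 * α * ε * E * (‖B x₀‖ + 1) := by positivity
    rw [Prod.dist_eq, Prod.dist_eq, dist_self]
    refine max_le (by positivity) (max_le ?_ (by linarith))
    rw [Real.dist_eq, sub_sub_cancel_left, abs_neg, abs_of_nonneg h0]
    linarith
  have hG2 : G (y, ψ y - ε * E, p y)
      ≤ G (y, ψ y, q y) + L * (ε * E + 2 * α * ε * E * (‖B x₀‖ + 1)) := by
    have h1 := (le_abs_self _).trans ((Real.dist_eq _ _).symm.trans_le hlip)
    have h2 := mul_le_mul_of_nonneg_left hdist L.coe_nonneg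
    linarith
  have hkey : (ε * E) * (4 * α ^ 2 * A y - 2 * α * K y)
      ≤ (ε * E) * (L * (1 + 2 * α * (‖B x₀‖ + 1))) := by
    linarith
  have hkey' := le_of_mul_le_mul_left hkey (by positivity)
  have h1 : α ^ 2 * (A x₀ / 2) ≤ α ^ 2 * A y := by gcongr
  have h2 : α * K y ≤ α * (|K x₀| + 1) := by gcongr
  have h3 : 0 ≤ α * (L : ℝ) := by positivity
  have h4 : 0 ≤ (L : ℝ) * (‖B x₀‖ + 1) := by positivity
  have h5 := abs_nonneg (K x₀)
  linarith

/-- Hopf type lemma: the vector fields of a sum of squares decomposition of the principal part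
are tangent to the set where `φ - ψ` attains its maximum. -/
lemma tangentTo_of_sum_sq {N r : ℕ} {Ω : Set (Fin N → ℝ)} (hΩ : IsOpen Ω)
    {e : Fin N → (Fin N → ℝ) → (Fin N → ℝ)} (he : ∀ i, ContDiffOn ℝ (⊤ : ℕ∞) (e i) Ω)
    {a : (Fin N → ℝ) → (Fin N → ℝ) → Matrix (Fin N) (Fin N) ℝ}
    {b : (Fin N → ℝ) → ℝ → (Fin N → ℝ) → ℝ}
    (ha : ∀ i j, ContDiffOn ℝ (⊤ : ℕ∞)
      (fun q : (Fin N → ℝ) × (Fin N → ℝ) => a q.1 q.2 i j) (Ω ×ˢ (Set.univ : Set (Fin N → ℝ))))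
    (hb : ContDiffOn ℝ (⊤ : ℕ∞) (fun q : (Fin N → ℝ) × ℝ × (Fin N → ℝ) => b q.1 q.2.1 q.2.2)
      (Ω ×ˢ (Set.univ : Set (ℝ × (Fin N → ℝ)))))
    {φ ψ : (Fin N → ℝ) → ℝ} (hφ : ContDiffOn ℝ (⊤ : ℕ∞) φ Ω) (hψ : ContDiffOn ℝ (⊤ : ℕ∞) ψ Ω)
    (hQ : ∀ x ∈ Ω, Qop' N e a b ψ x ≤ Qop' N e a b φ x)
    (hsym : ∀ x p i j, a x p i j = a x p j i)
    (hnonneg : ∀ x p (ξ : Fin N → ℝ), 0 ≤ ∑ i, ∑ j, a x p i j * ξ i * ξ j)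
    (hbz : ∀ x z p, deriv (fun t : ℝ => b x t p) z ≤ 0)
    {X : Fin r → (Fin N → ℝ) → (Fin N → ℝ)}
    (hsymbol : ∀ x ∈ Ω, ∀ ν, ∑ i, ∑ j, a x (fun k => vApp (e k) φ x) i j *
      ((ν ⬝ᵥ e i x) * (ν ⬝ᵥ e j x)) = ∑ k, (ν ⬝ᵥ X k x) ^ 2)
    {M : ℝ} (hM0 : 0 ≤ M) (hM : ∀ x ∈ Ω, φ x - ψ x ≤ M) (k : Fin r) :
    TangentTo {x ∈ Ω | φ x - ψ x = M} (X k) := by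
  rintro x₀ ⟨hx₀, hx₀M⟩ ν hν
  by_contra hne
  have hcd : ∀ {f : (Fin N → ℝ) → ℝ}, ContDiffOn ℝ (⊤ : ℕ∞) f Ω → DifferentiableAt ℝ f x₀ :=
    fun hf => (hf.contDiffAt (hΩ.mem_nhds hx₀)).differentiableAt (by simp)
  have hd : fderiv ℝ φ x₀ = fderiv ℝ ψ x₀ := by
    have hloc : IsLocalMax (fun x => φ x - ψ x) x₀ := by
      filter_upwards [hΩ.mem_nhds hx₀] with y hy
      rw [hx₀M]
      exact hM y hy
    have h1 := hloc.fderiv_eq_zero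
    rw [fderiv_fun_sub (hcd hφ) (hcd hψ)] at h1
    exact sub_eq_zero.1 h1
  set μ : Fin N → ℝ := (2⁻¹ : ℝ) • ν with hμ
  set c : Fin N → ℝ := x₀ + μ with hc
  have hxc : x₀ - c = -μ := by simp [hc]
  have hpos : 0 < ∑ i, ∑ j, a x₀ (fun k => vApp (e k) φ x₀) i j *
      (((x₀ - c) ⬝ᵥ e i x₀) * ((x₀ - c) ⬝ᵥ e j x₀)) := by
    rw [hsymbol x₀ hx₀]
    refine Finset.sum_pos' (fun _ _ => sq_nonneg _) ⟨k, Finset.mem_univ k, ?_⟩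
    have h1 : (x₀ - c) ⬝ᵥ X k x₀ ≠ 0 := by
      rw [hxc, hμ, neg_dotProduct, smul_dotProduct, dotProduct_comm]
      exact neg_ne_zero.2 (smul_ne_zero (by norm_num) hne)
    positivity
  obtain ⟨A, hA, C, s₀, hs₀, hbar⟩ := barrier_inequality hΩ he ha hb hφ hψ hQ hsym hnonneg hbz
    hx₀ hd c hpos
  obtain ⟨α, hα0, hα⟩ : ∃ α : ℝ, 0 < α ∧ C * (1 + α) < α ^ 2 * A := by
    refine ⟨1 + 2 * |C| / A, by positivity, ?_⟩
    have h1 := le_abs_self C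
    have h2 := abs_nonneg C
    have h3 : 0 ≤ |C| / A := by positivity
    have h4 : |C| / A * A = |C| := by field_simp
    have h5 : (1 + 2 * |C| / A) ^ 2 * A = A + 4 * |C| + 4 * (|C| / A) * |C| := by
      field_simp
      ring
    rw [h5]
    have h6 : C * (1 + (1 + 2 * |C| / A)) ≤ |C| * (1 + (1 + 2 * |C| / A)) := by gcongr
    have h7 : |C| * (1 + (1 + 2 * |C| / A)) = 2 * |C| + 2 * (|C| / A) * |C| := by ring
    nlinarith
  -- the maximum set stays strictly outside the ball centred at `c` except for `x₀`
  have hstrict : ∀ᶠ y in 𝓝 x₀, y ∈ Ω → φ y - ψ y = M → y ≠ x₀ →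
      gauss α c y < gauss α c x₀ := by
    filter_upwards [hν] with y hy hyΩ hyM hyx
    have h1 := hy ⟨hyΩ, hyM⟩
    have h2 : 0 < (y - x₀) ⬝ᵥ (y - x₀) := by
      refine lt_of_le_of_ne (by simpa using dotProduct_star_self_nonneg (y - x₀)) fun h => ?_
      exact hyx (sub_eq_zero.1 (dotProduct_self_eq_zero.1 h.symm))
    have h3 : (y - c) ⬝ᵥ (y - c) = (y - x₀) ⬝ᵥ (y - x₀) - (y - x₀) ⬝ᵥ ν
        + (x₀ - c) ⬝ᵥ (x₀ - c) := by
      have h4 : y - c = (y - x₀) + -μ := by rw [← hxc]; abel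
      rw [hxc, h4]
      simp only [hμ, add_dotProduct, dotProduct_add, neg_dotProduct, dotProduct_neg,
        smul_dotProduct, dotProduct_smul, smul_eq_mul, dotProduct_comm ν (y - x₀)]
      ring
    refine Real.exp_lt_exp.2 (neg_lt_neg (mul_lt_mul_of_pos_left ?_ hα0))
    linarith
  obtain ⟨ρ, hρ, hball⟩ := Metric.nhds_basis_closedBall.eventually_iff.1
    (hbar.and (hstrict.and (hΩ.eventually_mem hx₀)))
  have hcont : ContinuousOn (fun y => φ y - ψ y) (Metric.closedBall x₀ ρ) :=
    (hφ.continuousOn.sub hψ.continuousOn).mono fun y hy => (hball hy).2.2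
  have hgc : Continuous (gauss α c) := (contDiff_gauss α c).continuous
  set E₀ := gauss α c x₀ with hE₀
  obtain ⟨δ, hδ, hδM⟩ : ∃ δ > 0, ∀ y ∈ Metric.sphere x₀ ρ, E₀ ≤ gauss α c y →
      φ y - ψ y ≤ M - δ := by
    have hS : IsCompact (Metric.sphere x₀ ρ ∩ {y | E₀ ≤ gauss α c y}) :=
      (isCompact_sphere x₀ ρ).inter_right (isClosed_le continuous_const hgc)
    rcases (Metric.sphere x₀ ρ ∩ {y | E₀ ≤ gauss α c y}).eq_empty_or_nonempty with h0 | h0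
    · refine ⟨1, one_pos, fun y hy hyE => ?_⟩
      exact absurd (show y ∈ Metric.sphere x₀ ρ ∩ {y | E₀ ≤ gauss α c y} from ⟨hy, hyE⟩)
        (h0 ▸ Set.notMem_empty y)
    · obtain ⟨z, hz, hzmax⟩ := hS.exists_isMaxOn h0
        (hcont.mono fun y hy => Metric.sphere_subset_closedBall hy.1)
      have hzb := hball (Metric.sphere_subset_closedBall hz.1)
      have hzM : φ z - ψ z < M := lt_of_le_of_ne (hM z hzb.2.2) fun h =>
        (hzb.2.1 hzb.2.2 h (Metric.ne_of_mem_sphere hz.1 hρ.ne')).not_ge hz.2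
      refine ⟨M - (φ z - ψ z), by linarith, fun y hy hyE => ?_⟩
      have := hzmax (show y ∈ Metric.sphere x₀ ρ ∩ {y | E₀ ≤ gauss α c y} from ⟨hy, hyE⟩)
      simp only [Set.mem_ofPred_eq] at this
      linarith
  obtain ⟨ε, hε, hεδ⟩ := exists_between (lt_min hδ hs₀)
  have hεδ' := lt_min_iff.1 hεδ
  have hE₀pos : 0 < E₀ := gauss_pos α c x₀
  obtain ⟨y, hy, hymax⟩ := (isCompact_closedBall x₀ ρ).exists_isMaxOn
    ⟨x₀, Metric.mem_closedBall_self hρ.le⟩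
    (hcont.add ((continuous_const.mul hgc).continuousOn (s := Metric.closedBall x₀ ρ)) :
      ContinuousOn (fun y => φ y - ψ y + ε * gauss α c y) _)
  have hyx₀ : M + ε * E₀ ≤ φ y - ψ y + ε * gauss α c y :=
    hx₀M ▸ hymax (Metric.mem_closedBall_self hρ.le)
  have hyb := hball hy
  have hyball : y ∈ Metric.ball x₀ ρ := by
    refine lt_of_le_of_ne (Metric.mem_closedBall.1 hy) fun hys => ?_
    rcases lt_or_ge (gauss α c y) E₀ with h1 | h1
    · have := mul_lt_mul_of_pos_left h1 hε
      have := hM y hyb.2.2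
      linarith
    · have h2 := hδM y hys h1
      have h3 : ε * gauss α c y ≤ ε * 1 := by
        gcongr
        exact gauss_le_one hα0.le c y
      have : 0 < ε * E₀ := by positivity
      linarith
  have hloc : IsLocalMax (fun y => φ y - ψ y + ε * gauss α c y) y :=
    hymax.isLocalMax (mem_of_superset (Metric.isOpen_ball.mem_nhds hyball)
      Metric.ball_subset_closedBall)
  have hge : -(ε * gauss α c y) ≤ φ y - ψ y := by
    have : 0 < ε * E₀ := by positivity
    linarith
  exact (hyb.1 α ε hα0 hε hεδ'.2 hloc hge).not_gt hα

/-- Theorem A′: strong maximum principle for quasilinear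
operators of Bony type expressed in a moving frame `e₁,...,e_{m+1}`. -/
theorem strong_max_principle_quasilinear_frame
    (m : ℕ) (hm : 1 ≤ m)
    (Ω : Set (Fin (m + 1) → ℝ)) (hΩopen : IsOpen Ω) (hΩconn : IsConnected Ω)
    -- the moving frame
    (e : Fin (m + 1) → ((Fin (m + 1) → ℝ) → (Fin (m + 1) → ℝ)))
    (he_smooth : ∀ i, ContDiffOn ℝ (⊤ : ℕ∞) (e i) Ω)
    (he_indep : ∀ x ∈ Ω, LinearIndependent ℝ (fun i => e i x))
    (a : (Fin (m + 1) → ℝ) → (Fin (m + 1) → ℝ) → Matrix (Fin (m + 1)) (Fin (m + 1)) ℝ)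
    (b : (Fin (m + 1) → ℝ) → ℝ → (Fin (m + 1) → ℝ) → ℝ)
    (ha_smooth : ∀ i j, ContDiffOn ℝ (⊤ : ℕ∞)
      (fun q : (Fin (m + 1) → ℝ) × (Fin (m + 1) → ℝ) => a q.1 q.2 i j)
      (Ω ×ˢ (Set.univ : Set (Fin (m + 1) → ℝ))))
    (hb_smooth : ContDiffOn ℝ (⊤ : ℕ∞)
      (fun q : (Fin (m + 1) → ℝ) × ℝ × (Fin (m + 1) → ℝ) => b q.1 q.2.1 q.2.2)
      (Ω ×ˢ (Set.univ : Set (ℝ × (Fin (m + 1) → ℝ)))))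
    (φ ψ : (Fin (m + 1) → ℝ) → ℝ)
    (hφ : ContDiffOn ℝ (⊤ : ℕ∞) φ Ω) (hψ : ContDiffOn ℝ (⊤ : ℕ∞) ψ Ω)
    (hQ : ∀ x ∈ Ω, Qop' (m + 1) e a b ψ x ≤ Qop' (m + 1) e a b φ x)
    -- (1) symmetry and nonnegativity of `(a^{ij})`
    (hsym : ∀ x p i j, a x p i j = a x p j i)
    (hnonneg : ∀ x p (ξ : Fin (m + 1) → ℝ), 0 ≤ ∑ i, ∑ j, a x p i j * ξ i * ξ j)
    -- (2) `∂b/∂z ≤ 0`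
    (hbz : ∀ x z p, deriv (fun t : ℝ => b x t p) z ≤ 0)
    -- (3) sum-of-squares decomposition of `a^{ij}(x, e₁φ(x),...,e_{m+1}φ(x)) e_i e_j`
    (r : ℕ) (X : Fin r → ((Fin (m + 1) → ℝ) → (Fin (m + 1) → ℝ)))
    (Y : (Fin (m + 1) → ℝ) → (Fin (m + 1) → ℝ))
    (hX : ∀ k, ContDiffOn ℝ (⊤ : ℕ∞) (X k) Ω)
    (hY : ContDiffOn ℝ (⊤ : ℕ∞) Y Ω)
    (hdecomp : ∀ f : (Fin (m + 1) → ℝ) → ℝ, ContDiff ℝ 2 f → ∀ x ∈ Ω,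
      (∑ i, ∑ j, a x (fun k => vApp (e k) φ x) i j * vApp (e i) (vApp (e j) f) x)
        = (∑ k, vApp (X k) (vApp (X k) f) x) + vApp Y f x)
    -- `Γ` an integral curve of `Z ∈ £(X₁,...,X_r)`
    (Z : (Fin (m + 1) → ℝ) → (Fin (m + 1) → ℝ)) (hZ : LieSpan Ω (Set.range X) Z)
    (I : Set ℝ) (hIopen : IsOpen I) (hIconn : IsPreconnected I)
    (γ : ℝ → (Fin (m + 1) → ℝ)) (hγΩ : ∀ t ∈ I, γ t ∈ Ω)
    (hγ : ∀ t ∈ I, HasDerivAt γ (Z (γ t)) t)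
    -- `φ − ψ` attains a nonnegative maximum over `Ω` at a point of `Γ`
    (t₀ : ℝ) (ht₀ : t₀ ∈ I)
    (hmax : ∀ x ∈ Ω, φ x - ψ x ≤ φ (γ t₀) - ψ (γ t₀))
    (hnn : 0 ≤ φ (γ t₀) - ψ (γ t₀)) :
    ∀ t ∈ I, φ (γ t) - ψ (γ t) = φ (γ t₀) - ψ (γ t₀) := by
  set M := φ (γ t₀) - ψ (γ t₀)
  set F : Set (Fin (m + 1) → ℝ) := {x ∈ Ω | φ x - ψ x = M}
  have hFΩ : F ⊆ Ω := fun x hx => hx.1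
  have hFo : IsOpen (Ω \ F) := by
    have h1 : Ω \ F = Ω ∩ (φ - ψ) ⁻¹' {M}ᶜ :=
      Set.ext fun x => ⟨fun hx => ⟨hx.1, fun h => hx.2 ⟨hx.1, h⟩⟩,
        fun hx => ⟨hx.1, fun h => hx.2 h.2⟩⟩
    rw [h1]
    exact (hφ.continuousOn.sub hψ.continuousOn).isOpen_inter_preimage hΩopen
      isOpen_compl_singleton
  have hsymbol : ∀ x ∈ Ω, ∀ ν, ∑ i, ∑ j, a x (fun k => vApp (e k) φ x) i j *
      ((ν ⬝ᵥ e i x) * (ν ⬝ᵥ e j x)) = ∑ k, (ν ⬝ᵥ X k x) ^ 2 := fun x hx =>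
    sum_mul_dotProduct_eq_of_forall_vApp
      (fun i => ((he_smooth i).contDiffAt (hΩopen.mem_nhds hx)).differentiableAt (by simp))
      (fun k => ((hX k).contDiffAt (hΩopen.mem_nhds hx)).differentiableAt (by simp))
      fun f hf => hdecomp f hf x hx
  have hXF : ∀ W ∈ Set.range X, ContDiffOn ℝ (⊤ : ℕ∞) W Ω ∧ TangentTo F W := by
    rintro _ ⟨k, rfl⟩
    exact ⟨hX k, tangentTo_of_sum_sq hΩopen he_smooth ha_smooth hb_smooth hφ hψ hQ hsym hnonneg
      hbz hsymbol hnn hmax k⟩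
  have hZF := LieSpan.contDiffOn_and_tangentTo hΩopen hFΩ hFo hXF hZ
  intro t ht
  exact (hZF.2.mem_of_isPreconnected hΩopen hFΩ hFo (hZF.1.of_le (by simp)) hIopen hIconn hγΩ hγ
    ht₀ ⟨hγΩ t₀ ht₀, rfl⟩ t ht).2
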